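/- Let n ≥ 1 and let λ, μ be partitions each with at most n parts. Let λ∪1ⁿ denote the partition (λ_1+1, …, λ_n+1) obtained from λ by adding one box to each of the first n rows (with λ_i = 0 for i exceeding the number of parts of λ), so that (λ∪1ⁿ)‾ = (n, λ̄_1, λ̄_2, …). Then λ̄ is interlaced under μ̄ if and only if μ̄ is interlaced under (λ∪1ⁿ)‾; equivalently, (λ̄)F(μ̄) ≠ 0 if and only if (μ̄)F((λ∪1ⁿ)‾) ≠ 0. In particular (λ̄)F((λ∪1ⁿ)‾) ≠ 0. Moreover, when these spaces are nonzero, (λ̄‖μ̄)·(μ̄‖(λ∪1ⁿ)‾) = (λ̄‖(λ∪1ⁿ)‾) in F. -/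

import Mathlib

/-- Partitions, encoded as weakly decreasing finitely supported sequences
`λ = (λ_1, λ_2, …)` of natural numbers (0-based: entry `i` is `λ_{i+1}`). -/
def Ptn : Type := {f : ℕ →₀ ℕ // ∀ i, f (i + 1) ≤ f i}

/-- The size `|λ|` of a partition. -/
def ptnSize (l : Ptn) : ℕ := l.1.sum fun _ m => m

/-- The covering relation of the Young lattice: `λ ⊆ μ` and `|μ| = |λ| + 1`,
i.e. there is an arrow `λ → μ` in the quiver `Γ`. -/
def PCovers (l m : Ptn) : Prop := (∀ i, l.1 i ≤ m.1 i) ∧ ptnSize m = ptnSize l + 1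

/-- `η∖λ` consists of two boxes in the same column, i.e. `η∖λ = (1²)`. -/
def SameColumn (l h : Ptn) : Prop :=
  ∃ i, h.1 i = l.1 i + 1 ∧ h.1 (i + 1) = l.1 (i + 1) + 1 ∧ l.1 i = l.1 (i + 1) ∧
    ∀ r, r ≠ i → r ≠ i + 1 → h.1 r = l.1 r

/-- Generators of the quiver algebra `F`: an idempotent `(λ)` for each vertex and
a generator `(λ|μ)` for each arrow `λ → μ` of `Γ`. -/
inductive FGen : Type where
  | idem (l : Ptn)
  | arr (l m : Ptn)

variable (K : Type) [Field K] [CharZero K]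

/-- The defining relations of the algebra `F`: the path algebra relations of the
quiver `Γ` together with the commuting-square relations
`(λ|μ)(μ|η) = (λ|ν)(ν|η)` and the relations `(λ|μ)(μ|η) = 0` when
`η∖λ = (1²)`. -/
inductive FRel : FreeAlgebra K FGen → FreeAlgebra K FGen → Prop where
  | idem_sq (l : Ptn) :
      FRel (FreeAlgebra.ι K (FGen.idem l) * FreeAlgebra.ι K (FGen.idem l))
        (FreeAlgebra.ι K (FGen.idem l))
  | idem_orth (l m : Ptn) (h : l ≠ m) :
      FRel (FreeAlgebra.ι K (FGen.idem l) * FreeAlgebra.ι K (FGen.idem m)) 0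
  | arr_not_cover (l m : Ptn) (h : ¬ PCovers l m) :
      FRel (FreeAlgebra.ι K (FGen.arr l m)) 0
  | idem_arr (l m : Ptn) :
      FRel (FreeAlgebra.ι K (FGen.idem l) * FreeAlgebra.ι K (FGen.arr l m))
        (FreeAlgebra.ι K (FGen.arr l m))
  | idem_arr_ne (l m n : Ptn) (h : n ≠ l) :
      FRel (FreeAlgebra.ι K (FGen.idem n) * FreeAlgebra.ι K (FGen.arr l m)) 0
  | arr_idem (l m : Ptn) :
      FRel (FreeAlgebra.ι K (FGen.arr l m) * FreeAlgebra.ι K (FGen.idem m))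
        (FreeAlgebra.ι K (FGen.arr l m))
  | arr_idem_ne (l m n : Ptn) (h : n ≠ m) :
      FRel (FreeAlgebra.ι K (FGen.arr l m) * FreeAlgebra.ι K (FGen.idem n)) 0
  | square (l m n e : Ptn) (h1 : PCovers l m) (h2 : PCovers l n) (h3 : PCovers m e)
      (h4 : PCovers n e) (h : m ≠ n) :
      FRel (FreeAlgebra.ι K (FGen.arr l m) * FreeAlgebra.ι K (FGen.arr m e))
        (FreeAlgebra.ι K (FGen.arr l n) * FreeAlgebra.ι K (FGen.arr n e))
  | column (l m e : Ptn) (h1 : PCovers l m) (h2 : PCovers m e) (h : SameColumn l e) :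
      FRel (FreeAlgebra.ι K (FGen.arr l m) * FreeAlgebra.ι K (FGen.arr m e)) 0

/-- The algebra `F`. -/
abbrev FAlg : Type := RingQuot (FRel K)

/-- The idempotent `(λ) ∈ F`. -/
def eP (l : Ptn) : FAlg K := RingQuot.mkAlgHom K (FRel K) (FreeAlgebra.ι K (FGen.idem l))

/-- The arrow generator `(λ|μ) ∈ F`. -/
def aP (l m : Ptn) : FAlg K := RingQuot.mkAlgHom K (FRel K) (FreeAlgebra.ι K (FGen.arr l m))

/-- The component `(λ)F(μ) = (λ)·F·(μ)`. -/
def Fspace (l m : Ptn) : Submodule K (FAlg K) :=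
  LinearMap.range ((LinearMap.mulLeft K (eP K l)).comp (LinearMap.mulRight K (eP K m)))

/-- `λ` is interlaced under `μ`: `μ_i ≥ λ_i ≥ μ_{i+1}` for all `i ≥ 1`. -/
def Interlaced (l m : Ptn) : Prop := ∀ i, l.1 i ≤ m.1 i ∧ m.1 (i + 1) ≤ l.1 i

/-- The product in `F` of the arrow generators along the path
`l → p₀ → p₁ → ⋯` (an empty path contributes the idempotent `(l)`). -/
def prodAlong : Ptn → List Ptn → FAlg K
  | l, [] => eP K l
  | l, m :: rest => aP K l m * prodAlong m rest

/-- `p` is the list of successive vertices (after `l`) of a directed path in `Γ`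
from `l` to `m`. -/
def IsPath (l m : Ptn) (p : List Ptn) : Prop :=
  List.Chain PCovers l p ∧ (l :: p).getLast (List.cons_ne_nil l p) = m

/-- The conjugate partition: `ν̄_{i+1} = #{j : ν_j ≥ i+1}` (0-based index `i`). -/
noncomputable def conjFun (l : Ptn) (i : ℕ) : ℕ :=
  (l.1.support.filter (fun j => i + 1 ≤ l.1 j)).card

theorem ptnSize_eq_degree (l : Ptn) : ptnSize l = l.1.degree := rfl

theorem Ptn.ext_apply {l m : Ptn} (h : ∀ i, l.1 i = m.1 i) : l = m :=
  Subtype.ext (Finsupp.ext h)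

theorem ptnSize_sub_of_le {l m : Ptn} (h : ∀ i, l.1 i ≤ m.1 i) :
    ptnSize m = (m.1 - l.1).degree + ptnSize l := by
  rw [ptnSize_eq_degree, ptnSize_eq_degree, ← map_add, tsub_add_cancel_of_le]
  exact h

theorem ptnSize_mono {l m : Ptn} (h : ∀ i, l.1 i ≤ m.1 i) : ptnSize l ≤ ptnSize m := by
  have := ptnSize_sub_of_le h
  omega

theorem eq_of_le_of_ptnSize_le {l m : Ptn} (h : ∀ i, l.1 i ≤ m.1 i)
    (hs : ptnSize m ≤ ptnSize l) : l = m := by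
  have h1 := ptnSize_sub_of_le h
  have h2 : (m.1 - l.1).degree = 0 := by omega
  rw [Finsupp.degree_eq_zero_iff] at h2
  refine Ptn.ext_apply fun i => ?_
  have h3 := DFunLike.congr_fun h2 i
  have h4 := h i
  simp only [Finsupp.tsub_apply, Finsupp.zero_apply] at h3
  omega

/-- The partition obtained by adding a box in row `j`, assuming that row `j` is addable. -/
noncomputable def addBox (l : Ptn) (j : ℕ) (h : ∀ k, k + 1 = j → l.1 j < l.1 k) : Ptn :=
  ⟨l.1 + Finsupp.single j 1, fun i => by
    have h1 := l.2 i
    simp only [Finsupp.add_apply, Finsupp.single_apply]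
    by_cases hi : i + 1 = j
    · have := h i hi
      subst hi
      simp
      omega
    · rw [if_neg (fun e => hi e.symm)]
      omega⟩

theorem addBox_apply (l : Ptn) (j : ℕ) (h : ∀ k, k + 1 = j → l.1 j < l.1 k) (i : ℕ) :
    (addBox l j h).1 i = l.1 i + if j = i then 1 else 0 := by
  simp [addBox, Finsupp.single_apply]

theorem ptnSize_addBox (l : Ptn) (j : ℕ) (h : ∀ k, k + 1 = j → l.1 j < l.1 k) :
    ptnSize (addBox l j h) = ptnSize l + 1 := by
  rw [ptnSize_eq_degree, ptnSize_eq_degree, addBox, map_add, Finsupp.degree_single]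

theorem pCovers_addBox (l : Ptn) (j : ℕ) (h : ∀ k, k + 1 = j → l.1 j < l.1 k) :
    PCovers l (addBox l j h) :=
  ⟨fun i => by rw [addBox_apply]; omega, ptnSize_addBox l j h⟩

theorem addBox_le {l m : Ptn} (hlm : ∀ i, l.1 i ≤ m.1 i) (j : ℕ)
    (h : ∀ k, k + 1 = j → l.1 j < l.1 k) (hj : l.1 j < m.1 j) (i : ℕ) :
    (addBox l j h).1 i ≤ m.1 i := by
  rw [addBox_apply]
  have := hlm i
  split_ifs with e
  · subst e; omega
  · omega

/-- The first row of `m` longer than that of `l` is addable to `l`. -/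
theorem exists_first_addable {l m : Ptn} {i : ℕ} (hi : l.1 i < m.1 i) :
    ∃ j ≤ i, l.1 j < m.1 j ∧ ∀ k, k + 1 = j → l.1 j < l.1 k := by
  classical
  have hex : ∃ j, l.1 j < m.1 j := ⟨i, hi⟩
  refine ⟨Nat.find hex, Nat.find_min' hex hi, Nat.find_spec hex, fun k hk => ?_⟩
  have h1 := Nat.find_spec hex
  have h2 := Nat.find_min hex (m := k) (by omega)
  rw [← hk] at h1 ⊢
  have h3 := m.2 k
  omega

theorem exists_lt_of_ne {l m : Ptn} (hlm : ∀ i, l.1 i ≤ m.1 i) (hne : l ≠ m) :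
    ∃ i, l.1 i < m.1 i := by
  by_contra! h
  exact hne (Ptn.ext_apply fun i => le_antisymm (hlm i) (h i))

/-- The union of two partitions. -/
noncomputable def ptnSup (a b : Ptn) : Ptn :=
  ⟨a.1 ⊔ b.1, fun i => by
    simp only [Finsupp.sup_apply]
    exact sup_le_sup (a.2 i) (b.2 i)⟩

/-- The intersection of two partitions. -/
noncomputable def ptnInf (a b : Ptn) : Ptn :=
  ⟨a.1 ⊓ b.1, fun i => by
    simp only [Finsupp.inf_apply]
    exact inf_le_inf (a.2 i) (b.2 i)⟩

theorem ptnSup_apply (a b : Ptn) (i : ℕ) : (ptnSup a b).1 i = max (a.1 i) (b.1 i) := rfl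

theorem ptnInf_apply (a b : Ptn) (i : ℕ) : (ptnInf a b).1 i = min (a.1 i) (b.1 i) := rfl

theorem ptnSize_sup_add_inf (a b : Ptn) :
    ptnSize (ptnSup a b) + ptnSize (ptnInf a b) = ptnSize a + ptnSize b := by
  simp only [ptnSize_eq_degree, ← map_add]
  congr 1
  ext i
  exact max_add_min _ _

theorem ptnSize_sup_of_covers {l a b : Ptn} (ha : PCovers l a) (hb : PCovers l b)
    (hab : a ≠ b) : ptnSize (ptnSup a b) = ptnSize l + 2 := by
  have h1 := ptnSize_sup_add_inf a b
  have hle : ∀ i, l.1 i ≤ (ptnInf a b).1 i := fun i => le_min (ha.1 i) (hb.1 i)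
  have h2 := ptnSize_mono hle
  have hlt : ptnSize (ptnInf a b) < ptnSize a := by
    by_contra! h
    have h3 := eq_of_le_of_ptnSize_le (fun i => min_le_left (a.1 i) (b.1 i)) h
    refine hab (eq_of_le_of_ptnSize_le (fun i => ?_) (by rw [ha.2, hb.2]))
    rw [← h3]
    exact min_le_right _ _
  have h4 := ha.2
  have h5 := hb.2
  omega

section Relations

variable (K : Type) [Field K]

theorem eP_mul_self (l : Ptn) : eP K l * eP K l = eP K l := by
  simpa only [map_mul, eP] using RingQuot.mkAlgHom_rel K (FRel.idem_sq (K := K) l)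

theorem eP_mul_eP_of_ne {l m : Ptn} (h : l ≠ m) : eP K l * eP K m = 0 := by
  simpa only [map_mul, map_zero, eP] using RingQuot.mkAlgHom_rel K (FRel.idem_orth (K := K) l m h)

theorem aP_of_not_covers {l m : Ptn} (h : ¬ PCovers l m) : aP K l m = 0 := by
  simpa only [map_zero, aP] using RingQuot.mkAlgHom_rel K (FRel.arr_not_cover (K := K) l m h)

theorem eP_mul_aP (l m : Ptn) : eP K l * aP K l m = aP K l m := by
  simpa only [map_mul, eP, aP] using RingQuot.mkAlgHom_rel K (FRel.idem_arr (K := K) l m)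

theorem eP_mul_aP_of_ne {l m n : Ptn} (h : n ≠ l) : eP K n * aP K l m = 0 := by
  simpa only [map_mul, map_zero, eP, aP] using
    RingQuot.mkAlgHom_rel K (FRel.idem_arr_ne (K := K) l m n h)

theorem aP_mul_eP (l m : Ptn) : aP K l m * eP K m = aP K l m := by
  simpa only [map_mul, eP, aP] using RingQuot.mkAlgHom_rel K (FRel.arr_idem (K := K) l m)

theorem aP_square {l m n e : Ptn} (h1 : PCovers l m) (h2 : PCovers l n) (h3 : PCovers m e)
    (h4 : PCovers n e) (h : m ≠ n) : aP K l m * aP K m e = aP K l n * aP K n e := by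
  simpa only [map_mul, aP] using
    RingQuot.mkAlgHom_rel K (FRel.square (K := K) l m n e h1 h2 h3 h4 h)

theorem aP_column {l m e : Ptn} (h1 : PCovers l m) (h2 : PCovers m e) (h : SameColumn l e) :
    aP K l m * aP K m e = 0 := by
  simpa only [map_mul, map_zero, aP] using
    RingQuot.mkAlgHom_rel K (FRel.column (K := K) l m e h1 h2 h)

/-- `PathProd K l m x` says that `x` is the product of the arrow generators along some directed
path from `l` to `m`. -/
inductive PathProd : Ptn → Ptn → FAlg K → Prop where
  | nil (l : Ptn) : PathProd l l (eP K l)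
  | cons {l a m : Ptn} {x : FAlg K} (h : PCovers l a) (hx : PathProd a m x) :
      PathProd l m (aP K l a * x)

variable {K}

theorem PathProd.le {l m : Ptn} {x : FAlg K} (h : PathProd K l m x) (i : ℕ) :
    l.1 i ≤ m.1 i := by
  induction h with
  | nil => exact le_rfl
  | cons h _ ih => exact (h.1 i).trans ih

theorem PathProd.eP_mul {l m : Ptn} {x : FAlg K} (h : PathProd K l m x) : eP K l * x = x := by
  cases h with
  | nil => exact eP_mul_self K l
  | cons => rw [← mul_assoc, eP_mul_aP]

theorem PathProd.mul_eP {l m : Ptn} {x : FAlg K} (h : PathProd K l m x) : x * eP K m = x := by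
  induction h with
  | nil l => exact eP_mul_self K l
  | cons _ _ ih => rw [mul_assoc, ih]

theorem PathProd.trans {l m n : Ptn} {x y : FAlg K} (hx : PathProd K l m x)
    (hy : PathProd K m n y) : PathProd K l n (x * y) := by
  induction hx with
  | nil => rwa [hy.eP_mul]
  | cons h _ ih =>
    rw [mul_assoc]
    exact .cons h (ih hy)

theorem PathProd.arrow {l m : Ptn} (h : PCovers l m) : PathProd K l m (aP K l m) := by
  rw [← aP_mul_eP]
  exact .cons h (.nil m)

theorem PathProd.exists_of_le {l m : Ptn} (hlm : ∀ i, l.1 i ≤ m.1 i) :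
    ∃ x, PathProd K l m x := by
  induction hN : ptnSize m - ptnSize l generalizing l with
  | zero =>
    obtain rfl := eq_of_le_of_ptnSize_le hlm (by omega)
    exact ⟨_, .nil l⟩
  | succ N ih =>
    have hne : l ≠ m := by rintro rfl; omega
    obtain ⟨i, hi⟩ := exists_lt_of_ne hlm hne
    obtain ⟨j, -, hj, hadd⟩ := exists_first_addable hi
    obtain ⟨x, hx⟩ := ih (addBox_le hlm j hadd hj) (by rw [ptnSize_addBox]; omega)
    exact ⟨_, .cons (pCovers_addBox l j hadd) hx⟩

theorem PathProd.not_self_of_covers {l a : Ptn} {x : FAlg K} (h : PCovers l a)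
    (hx : PathProd K a l x) : False := by
  have h1 := ptnSize_mono hx.le
  have h2 := h.2
  omega

theorem PathProd.unique {l m : Ptn} {x y : FAlg K} (hx : PathProd K l m x)
    (hy : PathProd K l m y) : x = y := by
  induction hN : ptnSize m - ptnSize l using Nat.strong_induction_on generalizing l x y with
  | _ N ih =>
  subst hN
  cases hx with
  | nil =>
    cases hy with
    | nil => rfl
    | cons h hy => exact (hy.not_self_of_covers h).elim
  | @cons _ a _ x ha hx =>
    cases hy with
    | nil => exact (hx.not_self_of_covers ha).elim
    | @cons _ b _ y hb hy =>
      have ha2 := ha.2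
      have hb2 := hb.2
      have ham := ptnSize_mono hx.le
      by_cases hab : a = b
      · subst hab
        rw [ih _ (by omega) hx hy rfl]
      · have hs := ptnSize_sup_of_covers ha hb hab
        have hae : PCovers a (ptnSup a b) := ⟨fun i => le_max_left _ _, by omega⟩
        have hbe : PCovers b (ptnSup a b) := ⟨fun i => le_max_right _ _, by omega⟩
        obtain ⟨z, hz⟩ := PathProd.exists_of_le (K := K) (l := ptnSup a b) (m := m)
          fun i => max_le (hx.le i) (hy.le i)
        rw [ih _ (by omega) hx (.cons hae hz) rfl, ih _ (by omega) hy (.cons hbe hz) rfl,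
          ← mul_assoc, ← mul_assoc, aP_square K ha hb hae hbe hab]

theorem pathProd_zero {l m : Ptn} (hlm : ∀ i, l.1 i ≤ m.1 i) {i : ℕ}
    (hi : l.1 i < m.1 (i + 1)) : PathProd K l m 0 := by
  induction hN : ptnSize m - ptnSize l using Nat.strong_induction_on generalizing l with
  | _ N ih =>
  subst hN
  have step : ∀ j (hadd : ∀ k, k + 1 = j → l.1 j < l.1 k), l.1 j < m.1 j → j ≠ i →
      PathProd K l m 0 := by
    intro j hadd hj hji
    have hle := addBox_le hlm j hadd hj
    have hs := ptnSize_mono hle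
    have hs' := ptnSize_addBox l j hadd
    have h0 := ih _ (by omega) hle (by rw [addBox_apply, if_neg hji]; omega) rfl
    simpa using PathProd.cons (pCovers_addBox l j hadd) h0
  have hi' : l.1 i < m.1 i := hi.trans_le (m.2 i)
  obtain ⟨j, -, hj, hadd⟩ := exists_first_addable hi'
  by_cases hji : j = i
  · subst hji
    have hl := l.2 j
    by_cases hcol : l.1 (j + 1) = l.1 j
    · have hadd' : ∀ k, k + 1 = j + 1 → (addBox l j hadd).1 (j + 1) < (addBox l j hadd).1 k := by
        intro k hk
        obtain rfl : k = j := by omega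
        simp [addBox_apply, hcol]
      have hle := addBox_le hlm j hadd hj
      obtain ⟨x, hx⟩ := PathProd.exists_of_le (K := K)
        (addBox_le hle (j + 1) hadd' (by simp [addBox_apply, hcol, hi]))
      have hc1 := pCovers_addBox l j hadd
      have hc2 := pCovers_addBox _ (j + 1) hadd'
      have hsame : SameColumn l (addBox (addBox l j hadd) (j + 1) hadd') := by
        refine ⟨j, by simp [addBox_apply], by simp [addBox_apply], hcol.symm, fun r h1 h2 => ?_⟩
        simp [addBox_apply, h1.symm, h2.symm]
      have := PathProd.cons hc1 (.cons hc2 hx)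
      rwa [← mul_assoc, aP_column K hc1 hc2 hsame, zero_mul] at this
    · refine step (j + 1) (fun k hk => ?_) (by omega) (by omega)
      obtain rfl : k = j := by omega
      omega
  · exact step j hadd hj hji

theorem PathProd.eq_zero_of_not_interlaced {l m : Ptn} {x : FAlg K} (hx : PathProd K l m x)
    (h : ¬ Interlaced l m) : x = 0 := by
  simp only [Interlaced, not_forall, not_and, not_le] at h
  obtain ⟨i, hi⟩ := h
  exact hx.unique (pathProd_zero hx.le (hi (hx.le i)))

open Classical in
/-- The action of a generator of `F` on the left module `F·(m)`, identified with a subspace of the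
space with basis the partitions by sending `(l‖m)` to the basis vector at `l`. -/
noncomputable def repGen (m : Ptn) : FGen → Module.End K (Ptn →₀ K)
  | .idem l => Finsupp.lsingle l ∘ₗ Finsupp.lapply l
  | .arr l a => if PCovers l a ∧ Interlaced l m ∧ Interlaced a m
      then Finsupp.lsingle l ∘ₗ Finsupp.lapply a else 0

open Classical in
theorem unit_mul_unit (a b c d : Ptn) :
    ((Finsupp.lsingle a ∘ₗ Finsupp.lapply b : Module.End K (Ptn →₀ K)) *
      (Finsupp.lsingle c ∘ₗ Finsupp.lapply d)) =
      if b = c then Finsupp.lsingle a ∘ₗ Finsupp.lapply d else 0 := by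
  refine LinearMap.ext fun v => ?_
  split_ifs with h
  · subst h
    simp
  · simp [Ne.symm h]

theorem Interlaced.of_le_of_le {l a e m : Ptn} (hl : Interlaced l m) (he : Interlaced e m)
    (hla : ∀ i, l.1 i ≤ a.1 i) (hae : ∀ i, a.1 i ≤ e.1 i) : Interlaced a m :=
  fun i => ⟨(hae i).trans (he i).1, (hl i).2.trans (hla i)⟩

theorem SameColumn.not_interlaced {l e m : Ptn} (h : SameColumn l e) (hl : Interlaced l m) :
    ¬ Interlaced e m := by
  intro he
  obtain ⟨i, -, h2, h3, -⟩ := h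
  have h4 := (hl i).2
  have h5 := (he (i + 1)).1
  omega

open Classical in
theorem repGen_arr_mul_arr (m : Ptn) {l a e : Ptn} (h1 : PCovers l a) (h2 : PCovers a e) :
    repGen (K := K) m (.arr l a) * repGen m (.arr a e) =
      if Interlaced l m ∧ Interlaced e m then Finsupp.lsingle l ∘ₗ Finsupp.lapply e else 0 := by
  simp only [repGen, h1, h2, true_and]
  by_cases hl : Interlaced l m <;> by_cases he : Interlaced e m
  · have ha := hl.of_le_of_le he h1.1 h2.1
    simp only [hl, ha, he, and_self, if_true, unit_mul_unit]
  all_goals simp [hl, he]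

theorem repGen_rel (m : Ptn) {x y : FreeAlgebra K FGen} (h : FRel K x y) :
    FreeAlgebra.lift K (repGen (K := K) m) x = FreeAlgebra.lift K (repGen (K := K) m) y := by
  classical
  induction h with
  | idem_sq l => simp [repGen, unit_mul_unit]
  | idem_orth l m h => simp [repGen, unit_mul_unit, h]
  | arr_not_cover l m h => simp [repGen, h]
  | idem_arr l m =>
    simp only [map_mul, FreeAlgebra.lift_ι_apply, repGen]
    split_ifs <;> simp [unit_mul_unit]
  | idem_arr_ne l m n h =>
    simp only [map_mul, map_zero, FreeAlgebra.lift_ι_apply, repGen]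
    split_ifs <;> simp [unit_mul_unit, h]
  | arr_idem l m =>
    simp only [map_mul, FreeAlgebra.lift_ι_apply, repGen]
    split_ifs <;> simp [unit_mul_unit]
  | arr_idem_ne l m n h =>
    simp only [map_mul, map_zero, FreeAlgebra.lift_ι_apply, repGen]
    split_ifs <;> simp [unit_mul_unit, Ne.symm h]
  | square l m n e h1 h2 h3 h4 h =>
    simp only [map_mul, FreeAlgebra.lift_ι_apply]
    rw [repGen_arr_mul_arr _ h1 h3, repGen_arr_mul_arr _ h2 h4]
  | column l m e h1 h2 h =>
    simp only [map_mul, map_zero, FreeAlgebra.lift_ι_apply]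
    rw [repGen_arr_mul_arr _ h1 h2, if_neg fun hle => h.not_interlaced hle.1 hle.2]

/-- The left module `F·(m)` as a representation of `F`. -/
noncomputable def rep (m : Ptn) : FAlg K →ₐ[K] Module.End K (Ptn →₀ K) :=
  RingQuot.liftAlgHom K ⟨FreeAlgebra.lift K (repGen m), fun _ _ h => repGen_rel m h⟩

theorem rep_eP (m l : Ptn) : rep m (eP K l) = repGen m (.idem l) := by
  simp [rep, eP]

theorem rep_aP (m l a : Ptn) : rep m (aP K l a) = repGen m (.arr l a) := by
  simp [rep, aP]

theorem Interlaced.refl (m : Ptn) : Interlaced m m := fun i => ⟨le_rfl, m.2 i⟩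

theorem PathProd.rep_apply {l m : Ptn} {x : FAlg K} (hx : PathProd K l m x)
    (h : Interlaced l m) : rep m x (Finsupp.single m 1) = Finsupp.single l 1 := by
  induction hx with
  | nil => simp [rep_eP, repGen]
  | @cons l a m x hla hx ih =>
    have ha := h.of_le_of_le (Interlaced.refl m) hla.1 hx.le
    rw [map_mul, Module.End.mul_apply, ih ha, rep_aP]
    simp [repGen, hla, h, ha]

theorem PathProd.ne_zero {l m : Ptn} {x : FAlg K} (hx : PathProd K l m x)
    (h : Interlaced l m) : x ≠ 0 := by
  rintro rfl
  have := hx.rep_apply h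
  rw [map_zero, LinearMap.zero_apply, eq_comm, Finsupp.single_eq_zero] at this
  exact one_ne_zero this

theorem mul_mem_span_pathProd (l : Ptn) (a : FreeAlgebra K FGen) :
    ∀ y ∈ Submodule.span K {y : FAlg K | ∃ m, PathProd K l m y},
      y * RingQuot.mkAlgHom K (FRel K) a ∈ Submodule.span K {y | ∃ m, PathProd K l m y} := by
  induction a using FreeAlgebra.induction with
  | grade0 r =>
    intro y hy
    rw [AlgHom.commutes, ← Algebra.commutes, ← Algebra.smul_def]
    exact Submodule.smul_mem _ _ hy
  | grade1 g =>
    intro y hy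
    induction hy using Submodule.span_induction with
    | zero => simp
    | add x y _ _ hx hy => rw [add_mul]; exact Submodule.add_mem _ hx hy
    | smul r x _ hx => rw [smul_mul_assoc]; exact Submodule.smul_mem _ _ hx
    | mem y hy =>
      obtain ⟨m, hy⟩ := hy
      cases g with
      | idem k =>
        change y * eP K k ∈ _
        by_cases hk : m = k
        · subst hk
          rw [hy.mul_eP]
          exact Submodule.subset_span ⟨m, hy⟩
        · rw [← hy.mul_eP, mul_assoc, eP_mul_eP_of_ne K hk, mul_zero]
          exact Submodule.zero_mem _
      | arr k k' =>
        change y * aP K k k' ∈ _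
        by_cases hk : m = k
        · subst hk
          by_cases hc : PCovers m k'
          · exact Submodule.subset_span ⟨k', hy.trans (.arrow hc)⟩
          · rw [aP_of_not_covers K hc, mul_zero]
            exact Submodule.zero_mem _
        · rw [← hy.mul_eP, mul_assoc, eP_mul_aP_of_ne K hk, mul_zero]
          exact Submodule.zero_mem _
  | mul a b ha hb =>
    intro y hy
    rw [map_mul, ← mul_assoc]
    exact hb _ (ha y hy)
  | add a b ha hb =>
    intro y hy
    rw [map_add, mul_add]
    exact Submodule.add_mem _ (ha y hy) (hb y hy)

theorem eP_mul_mul_eP_mem_span (l m : Ptn) (x : FAlg K) :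
    eP K l * x * eP K m ∈ Submodule.span K {y | PathProd K l m y} := by
  obtain ⟨a, rfl⟩ := RingQuot.mkAlgHom_surjective K (FRel K) x
  have h := mul_mem_span_pathProd l a (eP K l) (Submodule.subset_span ⟨l, .nil l⟩)
  generalize eP K l * RingQuot.mkAlgHom K (FRel K) a = z at h
  induction h using Submodule.span_induction with
  | zero => simp
  | add x y _ _ hx hy => rw [add_mul]; exact Submodule.add_mem _ hx hy
  | smul r x _ hx => rw [smul_mul_assoc]; exact Submodule.smul_mem _ _ hx
  | mem y hy =>
    obtain ⟨k, hy⟩ := hy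
    by_cases hk : k = m
    · subst hk
      rw [hy.mul_eP]
      exact Submodule.subset_span hy
    · rw [← hy.mul_eP, mul_assoc, eP_mul_eP_of_ne K hk, mul_zero]
      exact Submodule.zero_mem _

theorem PathProd.mem_Fspace {l m : Ptn} {x : FAlg K} (hx : PathProd K l m x) :
    x ∈ Fspace K l m :=
  ⟨x, by simp [hx.mul_eP, hx.eP_mul]⟩

theorem Fspace_ne_bot_iff (l m : Ptn) : Fspace K l m ≠ ⊥ ↔ Interlaced l m := by
  constructor
  · contrapose
    intro h
    rw [eq_bot_iff]
    rintro _ ⟨x, rfl⟩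
    have hx := eP_mul_mul_eP_mem_span l m x
    have h0 : Submodule.span K {y : FAlg K | PathProd K l m y} = ⊥ :=
      Submodule.span_eq_bot.2 fun y hy => hy.eq_zero_of_not_interlaced h
    rw [h0] at hx
    simpa [mul_assoc] using hx
  · intro h
    obtain ⟨x, hx⟩ := PathProd.exists_of_le (K := K) fun i => (h i).1
    exact fun hbot => hx.ne_zero h (by simpa [hbot] using hx.mem_Fspace)

theorem IsPath.pathProd {l m : Ptn} {p : List Ptn} (h : IsPath l m p) :
    PathProd K l m (prodAlong K l p) := by
  induction p generalizing l with
  | nil =>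
    obtain ⟨-, rfl⟩ := h
    exact .nil l
  | cons a p ih =>
    obtain ⟨hc, hl⟩ := h
    rw [List.getLast_cons (List.cons_ne_nil a p)] at hl
    rcases hc with _ | _ | ⟨h1, h2⟩
    exact .cons h1 (ih ⟨h2, hl⟩)

end Relations

theorem conjFun_succ_of_add_column {n : ℕ} {lam lam1 : Ptn}
    (hlam : ∀ i, n ≤ i → lam.1 i = 0)
    (hlam1 : ∀ i, i < n → lam1.1 i = lam.1 i + 1)
    (hlam1' : ∀ i, n ≤ i → lam1.1 i = 0) (i : ℕ) :
    conjFun lam1 (i + 1) = conjFun lam i := by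
  unfold conjFun
  congr 1
  ext j
  simp only [Finset.mem_filter, Finsupp.mem_support_iff]
  rcases lt_or_ge j n with h | h
  · have := hlam1 j h
    omega
  · have := hlam j h
    have := hlam1' j h
    omega

theorem conjFun_zero_of_add_column {n : ℕ} {lam lam1 : Ptn}
    (hlam1 : ∀ i, i < n → lam1.1 i = lam.1 i + 1)
    (hlam1' : ∀ i, n ≤ i → lam1.1 i = 0) : conjFun lam1 0 = n := by
  rw [conjFun, ← Finset.card_range n]
  congr 1
  ext j
  simp only [Finset.mem_filter, Finsupp.mem_support_iff, Finset.mem_range]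
  rcases lt_or_ge j n with h | h
  · have := hlam1 j h
    omega
  · have := hlam1' j h
    omega

theorem conjFun_le {n : ℕ} {mu : Ptn} (hmu : ∀ i, n ≤ i → mu.1 i = 0) (i : ℕ) :
    conjFun mu i ≤ n := by
  rw [← Finset.card_range n]
  refine Finset.card_le_card fun j hj => ?_
  simp only [Finset.mem_filter, Finsupp.mem_support_iff, Finset.mem_range] at hj ⊢
  by_contra! h
  exact hj.1 (hmu j h)

/-- Lemma 6.1: for partitions `λ, μ` with at most `n` parts and
`λ∪1ⁿ = (λ_1+1, …, λ_n+1)`, one has: `λ̄` is interlaced under `μ̄` iff `μ̄` is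
interlaced under `(λ∪1ⁿ)‾`, equivalently `(λ̄)F(μ̄) ≠ 0` iff
`(μ̄)F((λ∪1ⁿ)‾) ≠ 0`; in particular `(λ̄)F((λ∪1ⁿ)‾) ≠ 0`; and moreover
`(λ̄‖μ̄)·(μ̄‖(λ∪1ⁿ)‾) = (λ̄‖(λ∪1ⁿ)‾)` (the elements `(α‖β)` being realized as
products of arrow generators along any directed paths). -/
theorem serre_type_lemma (K : Type) [Field K] [CharZero K]
    (n : ℕ) (hn : 1 ≤ n) (lam mu lam1 lamB muB lam1B : Ptn)
    (hlam : ∀ i, n ≤ i → lam.1 i = 0)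
    (hmu : ∀ i, n ≤ i → mu.1 i = 0)
    (hlam1 : ∀ i, i < n → lam1.1 i = lam.1 i + 1)
    (hlam1' : ∀ i, n ≤ i → lam1.1 i = 0)
    (hlamB : ∀ i, lamB.1 i = conjFun lam i)
    (hmuB : ∀ i, muB.1 i = conjFun mu i)
    (hlam1B : ∀ i, lam1B.1 i = conjFun lam1 i) :
    (Interlaced lamB muB ↔ Interlaced muB lam1B) ∧
    (Fspace K lamB muB ≠ ⊥ ↔ Fspace K muB lam1B ≠ ⊥) ∧
    Fspace K lamB lam1B ≠ ⊥ ∧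
    (Interlaced lamB muB → ∀ p q r : List Ptn,
      IsPath lamB muB p → IsPath muB lam1B q → IsPath lamB lam1B r →
        prodAlong K lamB p * prodAlong K muB q = prodAlong K lamB r) := by
  have hB0 : lam1B.1 0 = n := (hlam1B 0).trans (conjFun_zero_of_add_column hlam1 hlam1')
  have hBs : ∀ i, lam1B.1 (i + 1) = lamB.1 i := fun i => by
    rw [hlam1B, hlamB, conjFun_succ_of_add_column hlam hlam1 hlam1']
  have hmuB0 : muB.1 0 ≤ n := (hmuB 0).trans_le (conjFun_le hmu 0)
  have hiff : Interlaced lamB muB ↔ Interlaced muB lam1B := by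
    constructor
    · intro h i
      refine ⟨?_, (hBs i).trans_le (h i).1⟩
      cases i with
      | zero => rwa [hB0]
      | succ i => rw [hBs]; exact (h i).2
    · intro h i
      exact ⟨(hBs i).symm.trans_le (h i).2, (h (i + 1)).1.trans_eq (hBs i)⟩
  refine ⟨hiff, ?_, ?_, ?_⟩
  · rw [Fspace_ne_bot_iff, Fspace_ne_bot_iff, hiff]
  · rw [Fspace_ne_bot_iff]
    exact fun i => ⟨(hBs i).symm.trans_le (lam1B.2 i), (hBs i).le⟩
  · intro _ p q r hp hq hr
    exact (hp.pathProd.trans hq.pathProd).unique hr.pathProd
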